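/- arXiv:math/9909068 — 3 statements merged into one kernel-verified Lean document; each statement's English description precedes it below -/
import Mathlib

section
/- Lemma 5.2: Let n ≥ 2 and l, k ≥ 1. Every isomorphism ι : B_l ⊗ B_k → B_k ⊗ B_l of U_q'(A_{2n−1}^(2)) crystals satisfies ι((l,0,…,0) ⊗ (k,0,…,0)) = (k,0,…,0) ⊗ (l,0,…,0). -/
namespace KTT

/-- Raw data of a crystal element `(x_1,…,x_n,x̄_n,…,x̄_1)`:
`b.1 i` is `x_{i+1}` and `b.2 i` is `x̄_{i+1}` for `i : Fin n`. -/
abbrev Tup (n : ℕ) := (Fin n → ℕ) × (Fin n → ℕ)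

/-- The entry `x_j` (for `1 ≤ j ≤ n`). -/
def xc {n : ℕ} (b : Tup n) (j : ℕ) : ℕ :=
  if h : j - 1 < n then b.1 ⟨j - 1, h⟩ else 0

/-- The entry `x̄_j` (for `1 ≤ j ≤ n`). -/
def xbc {n : ℕ} (b : Tup n) (j : ℕ) : ℕ :=
  if h : j - 1 < n then b.2 ⟨j - 1, h⟩ else 0

/-- Set the entry indexed by `j` (i.e. `x_j`) to the value `v`. -/
def setx {n : ℕ} (f : Fin n → ℕ) (j v : ℕ) : Fin n → ℕ :=
  fun t => if (t : ℕ) + 1 = j then v else f t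

/-- `Σ_{i=1}^n (x_i + x̄_i)`. -/
def tsum {n : ℕ} (b : Tup n) : ℕ := ∑ i, (b.1 i + b.2 i)

/-- The element `(v,0,…,0)`. -/
def uvec (n v : ℕ) : Tup n := (fun j => if (j : ℕ) = 0 then v else 0, fun _ => 0)

/-- The element `(0,v,---,0)` (only `x_2 = v` nonzero). -/
def u2vec (n v : ℕ) : Tup n := (fun j => if (j : ℕ) = 1 then v else 0, fun _ => 0)

/-- The element `(0,0,---,v)` (only `x̄_1 = v` nonzero). -/
def barvec (n v : ℕ) : Tup n := (fun _ => 0, fun j => if (j : ℕ) = 0 then v else 0)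

/-- The element `(a,c,---,d)` with `x_1 = a`, `x_2 = c`, `x̄_1 = d`, all else `0`. -/
def tripleVec (n a c d : ℕ) : Tup n :=
  (fun j => if (j : ℕ) = 0 then a else if (j : ℕ) = 1 then c else 0,
   fun j => if (j : ℕ) = 0 then d else 0)

/-! ### The `U_q'(C_n^{(1)})` crystal `B_l` -/

/-- Membership in the `C_n^{(1)}` crystal `B_l` : the sum of the entries belongs to
`{l, l-2, l-4, …}`. -/
def memC (n l : ℕ) (b : Tup n) : Prop := tsum b ≤ l ∧ (l - tsum b) % 2 = 0

def BC (n l : ℕ) : Set (Tup n) := {b | memC n l b}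

/-- The number `x_0(b)` of `(0,0̄)` pairs. -/
def x0 (l : ℕ) {n : ℕ} (b : Tup n) : ℕ := (l - tsum b) / 2

/-- The operator `ẽ_i` on `B_l` (C case); `none` plays the role of `0`. -/
def eC (n l i : ℕ) (b : Tup n) : Option (Tup n) :=
  if i = 0 then
    if 0 < n then
      if xbc b 1 + 2 ≤ xc b 1 then some (setx b.1 1 (xc b 1 - 2), b.2)
      else if xc b 1 = xbc b 1 + 1 then
        some (setx b.1 1 (xc b 1 - 1), setx b.2 1 (xbc b 1 + 1))
      else if tsum b + 2 ≤ l then some (b.1, setx b.2 1 (xbc b 1 + 2))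
      else none
    else none
  else if i = n then
    if 0 < xbc b n then some (setx b.1 n (xc b n + 1), setx b.2 n (xbc b n - 1))
    else none
  else if i < n then
    if xbc b (i + 1) < xc b (i + 1) then
      some (setx (setx b.1 i (xc b i + 1)) (i + 1) (xc b (i + 1) - 1), b.2)
    else if 0 < xbc b i then
      some (b.1, setx (setx b.2 (i + 1) (xbc b (i + 1) + 1)) i (xbc b i - 1))
    else none
  else none

/-- The operator `f̃_i` on `B_l` (C case). -/
def fC (n l i : ℕ) (b : Tup n) : Option (Tup n) :=
  if i = 0 then
    if 0 < n then
      if xbc b 1 ≤ xc b 1 then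
        if tsum b + 2 ≤ l then some (setx b.1 1 (xc b 1 + 2), b.2) else none
      else if xc b 1 + 1 = xbc b 1 then
        some (setx b.1 1 (xc b 1 + 1), setx b.2 1 (xbc b 1 - 1))
      else some (b.1, setx b.2 1 (xbc b 1 - 2))
    else none
  else if i = n then
    if 0 < xc b n then some (setx b.1 n (xc b n - 1), setx b.2 n (xbc b n + 1))
    else none
  else if i < n then
    if xbc b (i + 1) ≤ xc b (i + 1) then
      if 0 < xc b i then
        some (setx (setx b.1 i (xc b i - 1)) (i + 1) (xc b (i + 1) + 1), b.2)
      else none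
    else some (b.1, setx (setx b.2 (i + 1) (xbc b (i + 1) - 1)) i (xbc b i + 1))
  else none

def eCIter (n l i m : ℕ) (b : Tup n) : Option (Tup n) :=
  (fun o => Option.bind o (eC n l i))^[m] (some b)

def fCIter (n l i m : ℕ) (b : Tup n) : Option (Tup n) :=
  (fun o => Option.bind o (fC n l i))^[m] (some b)

/-- `ε_i(b) = max {m | ẽ_i^m b ≠ 0}` (C case). -/
noncomputable def epsC (n l i : ℕ) (b : Tup n) : ℕ :=
  sSup {m | eCIter n l i m b ≠ none}

/-- `φ_i(b) = max {m | f̃_i^m b ≠ 0}` (C case). -/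
noncomputable def phiC (n l i : ℕ) (b : Tup n) : ℕ :=
  sSup {m | fCIter n l i m b ≠ none}

/-- `ẽ_i` on the tensor product `B_l ⊗ B_k` (C case). -/
noncomputable def eTenC (n l k i : ℕ) (u : Tup n × Tup n) : Option (Tup n × Tup n) :=
  if epsC n k i u.2 ≤ phiC n l i u.1 then (eC n l i u.1).map (fun c => (c, u.2))
  else (eC n k i u.2).map (fun c => (u.1, c))

/-- `f̃_i` on the tensor product `B_l ⊗ B_k` (C case). -/
noncomputable def fTenC (n l k i : ℕ) (u : Tup n × Tup n) : Option (Tup n × Tup n) :=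
  if epsC n k i u.2 < phiC n l i u.1 then (fC n l i u.1).map (fun c => (c, u.2))
  else (fC n k i u.2).map (fun c => (u.1, c))

/-- `ι : B_l ⊗ B_k → B_k ⊗ B_l` is an isomorphism of `U_q'(C_n^{(1)})` crystals. -/
def IsIsoC (n l k : ℕ) (ι : Tup n × Tup n → Tup n × Tup n) : Prop :=
  Set.BijOn ι (BC n l ×ˢ BC n k) (BC n k ×ˢ BC n l) ∧
  ∀ u ∈ BC n l ×ˢ BC n k, ∀ i ≤ n,
    Option.map ι (eTenC n l k i u) = eTenC n k l i (ι u) ∧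
    Option.map ι (fTenC n l k i u) = fTenC n k l i (ι u)

/-- `H` is an energy function for the isomorphism `ι` (C case), normalized by
`H((l,0,…,0) ⊗ (0,k,---,0)) = 0`. -/
def IsEnergyC (n l k : ℕ) (ι : Tup n × Tup n → Tup n × Tup n)
    (H : Tup n × Tup n → ℤ) : Prop :=
  (∀ u ∈ BC n l ×ˢ BC n k, ∀ i ≤ n, ∀ v, eTenC n l k i u = some v →
      H v = H u +
        (if i = 0 then
          (if epsC n k 0 u.2 ≤ phiC n l 0 u.1 ∧ epsC n l 0 (ι u).2 ≤ phiC n k 0 (ι u).1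
           then 1
           else if phiC n l 0 u.1 < epsC n k 0 u.2 ∧ phiC n k 0 (ι u).1 < epsC n l 0 (ι u).2
           then -1 else 0)
         else 0)) ∧
  H (uvec n l, u2vec n k) = 0

/-! ### The `U_q'(A_{2n-1}^{(2)})` crystal `B_l` -/

def memA (n l : ℕ) (b : Tup n) : Prop := tsum b = l

def BA (n l : ℕ) : Set (Tup n) := {b | memA n l b}

/-- The operator `ẽ_i` (A case). -/
def eA (n i : ℕ) (b : Tup n) : Option (Tup n) :=
  if i = 0 then
    if 1 < n then
      if xbc b 2 < xc b 2 then some (setx b.1 2 (xc b 2 - 1), setx b.2 1 (xbc b 1 + 1))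
      else if 0 < xc b 1 then some (setx b.1 1 (xc b 1 - 1), setx b.2 2 (xbc b 2 + 1))
      else none
    else none
  else if i = n then
    if 0 < xbc b n then some (setx b.1 n (xc b n + 1), setx b.2 n (xbc b n - 1))
    else none
  else if i < n then
    if xbc b (i + 1) < xc b (i + 1) then
      some (setx (setx b.1 i (xc b i + 1)) (i + 1) (xc b (i + 1) - 1), b.2)
    else if 0 < xbc b i then
      some (b.1, setx (setx b.2 (i + 1) (xbc b (i + 1) + 1)) i (xbc b i - 1))
    else none
  else none

/-- The operator `f̃_i` (A case). -/
def fA (n i : ℕ) (b : Tup n) : Option (Tup n) :=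
  if i = 0 then
    if 1 < n then
      if xbc b 2 ≤ xc b 2 then
        if 0 < xbc b 1 then some (setx b.1 2 (xc b 2 + 1), setx b.2 1 (xbc b 1 - 1))
        else none
      else some (setx b.1 1 (xc b 1 + 1), setx b.2 2 (xbc b 2 - 1))
    else none
  else if i = n then
    if 0 < xc b n then some (setx b.1 n (xc b n - 1), setx b.2 n (xbc b n + 1))
    else none
  else if i < n then
    if xbc b (i + 1) ≤ xc b (i + 1) then
      if 0 < xc b i then
        some (setx (setx b.1 i (xc b i - 1)) (i + 1) (xc b (i + 1) + 1), b.2)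
      else none
    else some (b.1, setx (setx b.2 (i + 1) (xbc b (i + 1) - 1)) i (xbc b i + 1))
  else none

def eAIter (n i m : ℕ) (b : Tup n) : Option (Tup n) :=
  (fun o => Option.bind o (eA n i))^[m] (some b)

def fAIter (n i m : ℕ) (b : Tup n) : Option (Tup n) :=
  (fun o => Option.bind o (fA n i))^[m] (some b)

noncomputable def epsA (n i : ℕ) (b : Tup n) : ℕ :=
  sSup {m | eAIter n i m b ≠ none}

noncomputable def phiA (n i : ℕ) (b : Tup n) : ℕ :=
  sSup {m | fAIter n i m b ≠ none}

/-- `ẽ_i` on a tensor product (A case). -/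
noncomputable def eTenA (n i : ℕ) (u : Tup n × Tup n) : Option (Tup n × Tup n) :=
  if epsA n i u.2 ≤ phiA n i u.1 then (eA n i u.1).map (fun c => (c, u.2))
  else (eA n i u.2).map (fun c => (u.1, c))

/-- `f̃_i` on a tensor product (A case). -/
noncomputable def fTenA (n i : ℕ) (u : Tup n × Tup n) : Option (Tup n × Tup n) :=
  if epsA n i u.2 < phiA n i u.1 then (fA n i u.1).map (fun c => (c, u.2))
  else (fA n i u.2).map (fun c => (u.1, c))

/-- `ι : B_l ⊗ B_k → B_k ⊗ B_l` is an isomorphism of `U_q'(A_{2n-1}^{(2)})` crystals. -/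
def IsIsoA (n l k : ℕ) (ι : Tup n × Tup n → Tup n × Tup n) : Prop :=
  Set.BijOn ι (BA n l ×ˢ BA n k) (BA n k ×ˢ BA n l) ∧
  ∀ u ∈ BA n l ×ˢ BA n k, ∀ i ≤ n,
    Option.map ι (eTenA n i u) = eTenA n i (ι u) ∧
    Option.map ι (fTenA n i u) = fTenA n i (ι u)

/-- `H` is an energy function for `ι` (A case), normalized by
`H((l,0,…,0) ⊗ (0,0,---,k)) = 0`. -/
def IsEnergyA (n l k : ℕ) (ι : Tup n × Tup n → Tup n × Tup n)
    (H : Tup n × Tup n → ℤ) : Prop :=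
  (∀ u ∈ BA n l ×ˢ BA n k, ∀ i ≤ n, ∀ v, eTenA n i u = some v →
      H v = H u +
        (if i = 0 then
          (if epsA n 0 u.2 ≤ phiA n 0 u.1 ∧ epsA n 0 (ι u).2 ≤ phiA n 0 (ι u).1
           then 1
           else if phiA n 0 u.1 < epsA n 0 u.2 ∧ phiA n 0 (ι u).1 < epsA n 0 (ι u).2
           then -1 else 0)
         else 0)) ∧
  H (uvec n l, barvec n k) = 0

/-! ### Words, tableaux and column insertion

Letters are encoded as natural numbers: the unbarred letter `j` (for `0 ≤ j ≤ n`) is `j`,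
and the barred letter `j̄` is `2n+1-j`; the natural order of `ℕ` is the order
`0 < 1 < ⋯ < n < n̄ < ⋯ < 1̄ < 0̄`.  A (two-row) tableau is encoded as the list of its
columns (left to right), each column being the list of its entries (top to bottom). -/

/-- The barred partner `j̄` of an unbarred letter `j`. -/
def bar (n j : ℕ) : ℕ := 2 * n + 1 - j

/-- Column insertion of a letter into a tableau with at most two rows. -/
def insertLetter (n : ℕ) : ℕ → List (List ℕ) → List (List ℕ)
  | a, [] => [[a]]
  | a, [p] :: rest =>
      if a ≤ p then [a] :: insertLetter n p rest else [p, a] :: rest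
  | a, [p, q] :: rest =>
      if p ≠ 0 ∧ p ≤ n ∧ q = bar n p ∧ p ≤ a ∧ a ≤ q then
        -- the column is a pair `(x, x̄)` with `x ≠ 0` and `x ≤ a ≤ x̄`
        [p - 1, a] :: insertLetter n (bar n (p - 1)) rest
      else if n + 1 ≤ q ∧ bar n q < p ∧ p < q ∧ a = bar n q ∧ q ≠ n + 1 then
        -- the column is `(β, x̄)` with `x < β < x̄`, `a = x` and `x ≠ n`
        [a + 1, bar n (a + 1)] :: insertLetter n p rest
      else if a ≤ p then [a, q] :: insertLetter n p rest
      else if a ≤ q then [p, a] :: insertLetter n q rest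
      else [p, q, a] :: rest
  | a, C :: rest => (C ++ [a]) :: rest

/-- Column insertion of a word `u = u_1 ⋯ u_j` into a tableau: `u_j` first, `u_1` last. -/
def insertWord (n : ℕ) (u : List ℕ) (T : List (List ℕ)) : List (List ℕ) :=
  u.foldr (fun a T => insertLetter n a T) T

/-- One step of reverse insertion: letter `g` comes back (moving leftward) into a column;
returns the restored column together with the letter passed further left. -/
def revStep (n g : ℕ) (C : List ℕ) : List ℕ × ℕ :=
  match C with
  | [p] => ([g], p)
  | [p, q] =>
      if p ≠ 0 ∧ p ≤ n ∧ q = bar n p ∧ p ≤ g ∧ g ≤ q then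
        ([g, bar n (p - 1)], p - 1)
      else if p ≤ n ∧ g = bar n p ∧ p < q ∧ q < g ∧ p ≠ n then
        ([p + 1, bar n (p + 1)], q)
      else if q ≤ g then ([p, g], q)
      else ([g, q], p)
  | _ => (C, g)

/-- Reverse insertion of a letter through a list of columns, from right to left;
returns the new columns and the letter ejected from the leftmost column. -/
def revPass (n g : ℕ) : List (List ℕ) → List (List ℕ) × ℕ
  | [] => ([], g)
  | C :: rest =>
      let p := revPass n g rest
      let q := revStep n p.2 C
      (q.1 :: p.1, q.2)

/-- Reverse-bump the rightmost cell of the first row (the last column, a single box). -/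
def rbFirst (n : ℕ) (T : List (List ℕ)) : List (List ℕ) × ℕ :=
  match T.getLast? with
  | some [a] => revPass n a T.dropLast
  | _ => (T, 0)

/-- Number of columns of height (at least) two, i.e. the length of the second row. -/
def numTwoCols (T : List (List ℕ)) : ℕ :=
  (T.filter (fun C => decide (2 ≤ C.length))).length

/-- Reverse-bump the rightmost cell of the second row. -/
def rbSecond (n : ℕ) (T : List (List ℕ)) : List (List ℕ) × ℕ :=
  match (T.drop (numTwoCols T - 1)).head? with
  | some [a, b] =>
      let p := revPass n b (T.take (numTwoCols T - 1))
      (p.1 ++ [a] :: T.drop (numTwoCols T), p.2)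
  | _ => (T, 0)

/-- Iterate a reverse-bumping step, collecting the ejected letters in order of ejection. -/
def rbIter (step : List (List ℕ) → List (List ℕ) × ℕ) :
    ℕ → List (List ℕ) → List (List ℕ) × List ℕ
  | 0, T => (T, [])
  | c + 1, T =>
      let p := step T
      let q := rbIter step c p.1
      (q.1, p.2 :: q.2)

/-- A one-row word regarded as a tableau (list of one-box columns). -/
def rowCols (w : List ℕ) : List (List ℕ) := w.map (fun a => [a])

/-- The row word of a one-row tableau. -/
def colsWord (T : List (List ℕ)) : List ℕ := T.foldr (fun C acc => C ++ acc) []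

/-- The word `1^{x_1} ⋯ n^{x_n} n̄^{x̄_n} ⋯ 1̄^{x̄_1}`. -/
def coreWord (n : ℕ) (b : Tup n) : List ℕ :=
  ((List.finRange n).map (fun i => List.replicate (b.1 i) ((i : ℕ) + 1))).foldr (· ++ ·) []
  ++ ((List.finRange n).reverse.map
      (fun i => List.replicate (b.2 i) (bar n ((i : ℕ) + 1)))).foldr (· ++ ·) []

/-- The word `𝕋(b) = 0^{x_0} 1^{x_1} ⋯ 1̄^{x̄_1} 0̄^{x_0}` of an element of the
`C_n^{(1)}` crystal `B_l`. -/
def rowWordC (n l : ℕ) (b : Tup n) : List ℕ :=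
  List.replicate (x0 l b) 0 ++ coreWord n b ++ List.replicate (x0 l b) (bar n 0)

/-- The word `𝕋(b)` with `z` pairs `(0, 0̄)` removed. -/
def hatWordC (n l z : ℕ) (b : Tup n) : List ℕ :=
  List.replicate (x0 l b - z) 0 ++ coreWord n b ++ List.replicate (x0 l b - z) (bar n 0)

/-- The word `𝒯(b) = 1^{x_1} ⋯ 1̄^{x̄_1}` of an element of the `A_{2n-1}^{(2)}` crystal. -/
def rowWordA (n : ℕ) (b : Tup n) : List ℕ := coreWord n b


/-! ### Proof of Lemma 5.2 -/

def pot (n : ℕ) (b : Tup n) : ℕ := xc b 1 + xbc b 2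
def qot (n : ℕ) (b : Tup n) : ℕ := xc b 1 + xc b 2

/-- `x_1 = a`, `x_2 = c`. -/
def sv (n a c : ℕ) : Tup n :=
  (fun j => if (j : ℕ) = 0 then a else if (j : ℕ) = 1 then c else 0, fun _ => 0)
/-- `x_1 = a`, `x̄_2 = c`. -/
def tv (n a c : ℕ) : Tup n :=
  (fun j => if (j : ℕ) = 0 then a else 0, fun j => if (j : ℕ) = 1 then c else 0)

theorem sv_mem (m a c : ℕ) : sv (m+2) a c ∈ BA (m+2) (a+c) := by
  simp [BA, memA, tsum, sv, Fin.sum_univ_succ]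

theorem tv_mem (m a c : ℕ) : tv (m+2) a c ∈ BA (m+2) (a+c) := by
  simp [BA, memA, tsum, tv, Fin.sum_univ_succ]

theorem pot_f (m : ℕ) (b b' : Tup (m+2)) (h : fA (m+2) 1 b = some b') :
    pot _ b = pot _ b' + 1 := by
  simp only [fA] at h
  split_ifs at h <;> simp_all <;> subst h <;> simp_all [pot, xc, xbc, setx] <;> omega

theorem qot_e (m : ℕ) (b b' : Tup (m+2)) (h : eA (m+2) 0 b = some b') :
    qot _ b = qot _ b' + 1 := by
  simp only [eA] at h
  split_ifs at h <;> simp_all <;> subst h <;> simp_all [qot, xc, xbc, setx] <;> omega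

theorem pot_fT (m : ℕ) (b b' : Tup (m+2) × Tup (m+2)) (h : fTenA (m+2) 1 b = some b') :
    pot _ b.1 + pot _ b.2 = pot _ b'.1 + pot _ b'.2 + 1 := by
  simp only [fTenA] at h
  split_ifs at h <;> simp only [Option.map_eq_some_iff] at h <;> obtain ⟨a, h, rfl⟩ := h <;>
    have := pot_f _ _ _ h <;> simp <;> omega

theorem qot_eT (m : ℕ) (b b' : Tup (m+2) × Tup (m+2)) (h : eTenA (m+2) 0 b = some b') :
    qot _ b.1 + qot _ b.2 = qot _ b'.1 + qot _ b'.2 + 1 := by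
  simp only [eTenA] at h
  split_ifs at h <;> simp only [Option.map_eq_some_iff] at h <;> obtain ⟨a, h, rfl⟩ := h <;>
    have := qot_e _ _ _ h <;> simp <;> omega

theorem iter_none {α : Type*} (f : α → Option α) (m : ℕ) :
    (fun o => Option.bind o f)^[m] none = none := by
  induction m with
  | zero => rfl
  | succ m ih => rw [Function.iterate_succ_apply]; exact ih

theorem iter_le {α : Type*} (f : α → Option α) (P : α → ℕ)
    (hP : ∀ a b, f a = some b → P a = P b + 1) (m : ℕ) :
    ∀ a, (fun o => Option.bind o f)^[m] (some a) ≠ none → m ≤ P a := by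
  induction m with
  | zero => intros; omega
  | succ m ih =>
    intro a h
    rw [Function.iterate_succ_apply, Option.bind_some] at h
    rcases hb : f a with _ | b
    · rw [hb] at h; exact absurd (iter_none f m) h
    · rw [hb] at h
      have := ih b h
      have := hP _ _ hb
      omega

theorem sup_pos {α : Type*} (f : α → Option α) (P : α → ℕ)
    (hP : ∀ a b, f a = some b → P a = P b + 1) (a b : α) (h : f a = some b) :
    0 < sSup {m | (fun o => Option.bind o f)^[m] (some a) ≠ none} := by
  have : 1 ≤ sSup {m | (fun o => Option.bind o f)^[m] (some a) ≠ none} := by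
    apply le_csSup
    · exact ⟨P a, fun m hm => iter_le f P hP m a hm⟩
    · simp [h]
  omega

theorem sup_zero {α : Type*} (f : α → Option α) (a : α) (h : f a = none) :
    sSup {m | (fun o => Option.bind o f)^[m] (some a) ≠ none} = 0 := by
  have : {m | (fun o => Option.bind o f)^[m] (some a) ≠ none} ⊆ {0} := by
    intro m hm
    rcases m with _ | m
    · rfl
    · refine absurd ?_ hm
      rw [Function.iterate_succ_apply, Option.bind_some, h]
      exact iter_none f m
  rcases Set.subset_singleton_iff_eq.mp this with h | h <;> rw [h] <;> simp

theorem f_sv (m a c : ℕ) : fA (m+2) 1 (sv (m+2) (a+1) c) = some (sv (m+2) a (c+1)) := by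
  simp [fA, sv, xc, xbc, setx, funext_iff]
  intro x
  rcases eq_or_ne x 0 with rfl | hx
  · simp
  · simp [hx]
    split_ifs <;> rfl

theorem f_sv0 (m c : ℕ) : fA (m+2) 1 (sv (m+2) 0 c) = none := by
  simp [fA, sv, xc, xbc]

theorem e_sv0 (m a : ℕ) : eA (m+2) 1 (sv (m+2) a 0) = none := by
  simp [eA, sv, xc, xbc]

theorem e_tv (m a c : ℕ) : eA (m+2) 0 (tv (m+2) (a+1) c) = some (tv (m+2) a (c+1)) := by
  simp [eA, tv, xc, xbc, setx, funext_iff]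
  constructor <;> intro x <;> split_ifs <;> rfl

theorem e_tv0 (m c : ℕ) : eA (m+2) 0 (tv (m+2) 0 c) = none := by
  simp [eA, tv, xc, xbc]

theorem f_tv0 (m a : ℕ) : fA (m+2) 0 (tv (m+2) a 0) = none := by
  simp [fA, tv, xc, xbc]

theorem fT1 (m a c k : ℕ) : fTenA (m+2) 1 (sv _ (a+1) c, sv _ k 0) =
    some (sv _ a (c+1), sv _ k 0) := by
  have h1 : 0 < phiA (m+2) 1 (sv _ (a+1) c) := sup_pos _ _ (pot_f m) _ _ (f_sv m a c)
  have h2 : epsA (m+2) 1 (sv _ k 0) = 0 := sup_zero _ _ (e_sv0 m k)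
  simp [fTenA, h1, h2, f_sv]

theorem fT2 (m a c l : ℕ) : fTenA (m+2) 1 (sv _ 0 l, sv _ (a+1) c) =
    some (sv _ 0 l, sv _ a (c+1)) := by
  have h1 : phiA (m+2) 1 (sv _ 0 l) = 0 := sup_zero _ _ (f_sv0 m l)
  simp [fTenA, h1, f_sv]

theorem eT1 (m a c l : ℕ) : eTenA (m+2) 0 (tv _ l 0, tv _ (a+1) c) =
    some (tv _ l 0, tv _ a (c+1)) := by
  have h1 : 0 < epsA (m+2) 0 (tv _ (a+1) c) := sup_pos _ _ (qot_e m) _ _ (e_tv m a c)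
  have h2 : phiA (m+2) 0 (tv _ l 0) = 0 := sup_zero _ _ (f_tv0 m l)
  have h3 : epsA (m+2) 0 (tv _ (a+1) c) ≠ 0 := by omega
  simp [eTenA, h2, h3, e_tv]

theorem eT2 (m a c k : ℕ) : eTenA (m+2) 0 (tv _ (a+1) c, tv _ 0 k) =
    some (tv _ a (c+1), tv _ 0 k) := by
  have h1 : epsA (m+2) 0 (tv _ 0 k) = 0 := sup_zero _ _ (e_tv0 m k)
  simp [eTenA, h1, e_tv]

theorem stepP (m l k : ℕ) (ι) (hι : IsIsoA (m+2) l k ι) (u v)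
    (hu : u ∈ BA (m+2) l ×ˢ BA (m+2) k) (h : fTenA (m+2) 1 u = some v) :
    pot _ (ι u).1 + pot _ (ι u).2 = pot _ (ι v).1 + pot _ (ι v).2 + 1 := by
  have := (hι.2 u hu 1 (by omega)).2
  rw [h] at this
  exact pot_fT _ _ _ this.symm

theorem stepQ (m l k : ℕ) (ι) (hι : IsIsoA (m+2) l k ι) (u v)
    (hu : u ∈ BA (m+2) l ×ˢ BA (m+2) k) (h : eTenA (m+2) 0 u = some v) :
    qot _ (ι u).1 + qot _ (ι u).2 = qot _ (ι v).1 + qot _ (ι v).2 + 1 := by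
  have := (hι.2 u hu 0 (by omega)).1
  rw [h] at this
  exact qot_eT _ _ _ this.symm

theorem chainP2 (m l k : ℕ) (ι) (hι : IsIsoA (m+2) l k ι) : ∀ a c, a + c = k →
    a ≤ pot _ (ι (sv _ 0 l, sv _ a c)).1 + pot _ (ι (sv _ 0 l, sv _ a c)).2 := by
  intro a
  induction a with
  | zero => intros; omega
  | succ a ih =>
    intro c h
    have := ih (c+1) (by omega)
    have := stepP m l k ι hι _ _ ⟨by simpa using sv_mem m 0 l, h ▸ sv_mem m (a+1) c⟩ (fT2 m a c l)
    omega

theorem chainP1 (m l k : ℕ) (ι) (hι : IsIsoA (m+2) l k ι) : ∀ a c, a + c = l →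
    a + k ≤ pot _ (ι (sv _ a c, sv _ k 0)).1 + pot _ (ι (sv _ a c, sv _ k 0)).2 := by
  intro a
  induction a with
  | zero =>
    intro c h
    obtain rfl : c = l := by omega
    have := chainP2 m c k ι hι k 0 rfl
    omega
  | succ a ih =>
    intro c h
    have := ih (c+1) (by omega)
    have := stepP m l k ι hι _ _ ⟨h ▸ sv_mem m (a+1) c, sv_mem m k 0⟩ (fT1 m a c k)
    omega

theorem chainQ2 (m l k : ℕ) (ι) (hι : IsIsoA (m+2) l k ι) : ∀ a c, a + c = l →
    a ≤ qot _ (ι (tv _ a c, tv _ 0 k)).1 + qot _ (ι (tv _ a c, tv _ 0 k)).2 := by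
  intro a
  induction a with
  | zero => intros; omega
  | succ a ih =>
    intro c h
    have := ih (c+1) (by omega)
    have := stepQ m l k ι hι _ _ ⟨h ▸ tv_mem m (a+1) c, by simpa using tv_mem m 0 k⟩ (eT2 m a c k)
    omega

theorem chainQ1 (m l k : ℕ) (ι) (hι : IsIsoA (m+2) l k ι) : ∀ a c, a + c = k →
    a + l ≤ qot _ (ι (tv _ l 0, tv _ a c)).1 + qot _ (ι (tv _ l 0, tv _ a c)).2 := by
  intro a
  induction a with
  | zero =>
    intro c h
    obtain rfl : c = k := by omega
    have := chainQ2 m l c ι hι l 0 rfl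
    omega
  | succ a ih =>
    intro c h
    have := ih (c+1) (by omega)
    have := stepQ m l k ι hι _ _ ⟨tv_mem m l 0, h ▸ tv_mem m (a+1) c⟩ (eT1 m a c l)
    omega

theorem sv_u (n a : ℕ) : sv n a 0 = uvec n a := by simp [sv, uvec]
theorem tv_u (n a : ℕ) : tv n a 0 = uvec n a := by simp [tv, uvec]

theorem bd (m k : ℕ) (b : Tup (m+2)) (h : b ∈ BA (m+2) k) :
    pot _ b ≤ k ∧ qot _ b ≤ k ∧ (k ≤ pot _ b → k ≤ qot _ b → b = uvec _ k) := by
  have h' : tsum b = k := h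
  simp only [tsum, Fin.sum_univ_succ] at h'
  simp only [pot, qot, xc, xbc]
  have e1 : (⟨1, by omega⟩ : Fin (m+2)) = Fin.succ 0 := rfl
  have e0 : (⟨0, by omega⟩ : Fin (m+2)) = 0 := rfl
  simp [e1, e0] at *
  refine ⟨by omega, by omega, fun hp hq => ?_⟩
  have hs : ∑ i : Fin m, (b.1 i.succ.succ + b.2 i.succ.succ) = 0 := by omega
  rw [Finset.sum_eq_zero_iff] at hs
  ext j
  · refine Fin.cases ?_ (fun j => Fin.cases ?_ (fun j => ?_) j) j
    · simp [uvec]; omega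
    · simp [uvec]; omega
    · have := hs j (Finset.mem_univ _)
      simp [uvec]; omega
  · refine Fin.cases ?_ (fun j => Fin.cases ?_ (fun j => ?_) j) j
    · simp [uvec]; omega
    · simp [uvec]; omega
    · have := hs j (Finset.mem_univ _)
      simp [uvec]; omega

/-- **Lemma 5.2.**  Every isomorphism `ι : B_l ⊗ B_k → B_k ⊗ B_l` of `U_q'(A_{2n-1}^{(2)})`
crystals maps `(l,0,…,0) ⊗ (k,0,…,0)` to `(k,0,…,0) ⊗ (l,0,…,0)`. -/
theorem lemma_5_2
    (n l k : ℕ) (hn : 2 ≤ n) (hl : 1 ≤ l) (hk : 1 ≤ k)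
    (ι : Tup n × Tup n → Tup n × Tup n) (hι : IsIsoA n l k ι) :
    ι (uvec n l, uvec n k) = (uvec n k, uvec n l) := by
  obtain ⟨m, rfl⟩ : ∃ m, n = m + 2 := ⟨n - 2, by omega⟩
  have hP := chainP1 m l k ι hι l 0 rfl
  have hQ := chainQ1 m l k ι hι k 0 rfl
  have hm : (uvec (m+2) l, uvec (m+2) k) ∈ BA (m+2) l ×ˢ BA (m+2) k :=
    by
    rw [← sv_u, ← sv_u]
    exact ⟨sv_mem m l 0, sv_mem m k 0⟩
  have hi := hι.1.mapsTo hm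
  rw [sv_u, sv_u] at hP
  rw [tv_u, tv_u] at hQ
  obtain ⟨a1, a2, a3⟩ := bd m k _ hi.1
  obtain ⟨b1, b2, b3⟩ := bd m l _ hi.2
  exact Prod.ext (a3 (by omega) (by omega)) (b3 (by omega) (by omega))

end KTT
end

section
/- Let n ≥ 2 and l, k ≥ 1. In the U_q'(A_{2n−1}^(2)) crystal B_l ⊗ B_k, the element (l,0,…,0) ⊗ (k,0,…,0) is the unique element u such that ẽ_0^{l+k}(u) ≠ 0 and f̃_1^{l+k}(u) ≠ 0; that is, for u ∈ B_l ⊗ B_k one has both ẽ_0^{l+k}(u) ≠ 0 and f̃_1^{l+k}(u) ≠ 0 if and only if u = (l,0,…,0) ⊗ (k,0,…,0). -/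
namespace KTT

theorem iter_bound {β : Type*} (T : β → Option β) (G : β → ℕ)
    (h1 : ∀ u v, T u = some v → G u = G v + 1) (m : ℕ) :
    ∀ u, (fun o => Option.bind o T)^[m] (some u) ≠ none → m ≤ G u := by
  have hnone : ∀ m, (fun o => Option.bind o T)^[m] none = none := by
    intro m
    induction m with
    | zero => rfl
    | succ m ih => rw [Function.iterate_succ_apply]; exact ih
  induction m with
  | zero => intro u _; omega
  | succ m ih =>
    intro u hu
    rw [Function.iterate_succ_apply] at hu
    cases hT : T u with
    | none => simp [hT, hnone] at hu
    | some v =>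
      simp only [Option.bind_some, hT] at hu
      have := ih v hu
      have := h1 u v hT
      omega

theorem iter_exists {β : Type*} (T : β → Option β) (G : β → ℕ) (P : β → Prop)
    (h1 : ∀ u v, T u = some v → G u = G v + 1)
    (h2 : ∀ u, P u → 0 < G u → ∃ v, T u = some v ∧ P v) (m : ℕ) :
    ∀ u, P u → m ≤ G u → (fun o => Option.bind o T)^[m] (some u) ≠ none := by
  induction m with
  | zero => intro u _ _; simp
  | succ m ih =>
    intro u hP hu
    obtain ⟨v, hv, hPv⟩ := h2 u hP (by omega)
    rw [Function.iterate_succ_apply]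
    simp only [Option.bind_some, hv]
    have := h1 u v hv
    exact ih v hPv (by omega)

theorem iter_sSup {β : Type*} (T : β → Option β) (G : β → ℕ)
    (h1 : ∀ u v, T u = some v → G u = G v + 1)
    (h2 : ∀ u, 0 < G u → ∃ v, T u = some v) (u : β) :
    sSup {m | (fun o => Option.bind o T)^[m] (some u) ≠ none} = G u := by
  have : {m | (fun o => Option.bind o T)^[m] (some u) ≠ none} = Set.Iic (G u) := by
    ext m
    constructor
    · exact iter_bound T G h1 m u
    · exact iter_exists T G (fun _ => True) h1
        (fun u _ h => by obtain ⟨v, hv⟩ := h2 u h; exact ⟨v, hv, trivial⟩) m u trivial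
  rw [this, csSup_Iic]

theorem iter_sSup_zero {β : Type*} (T : β → Option β) (u : β) (h : T u = none) :
    sSup {m | (fun o => Option.bind o T)^[m] (some u) ≠ none} = 0 := by
  have hnone : ∀ m, (fun o => Option.bind o T)^[m] none = none := by
    intro m
    induction m with
    | zero => rfl
    | succ m ih => rw [Function.iterate_succ_apply]; exact ih
  have : {m | (fun o => Option.bind o T)^[m] (some u) ≠ none} = {0} := by
    ext m
    cases m with
    | zero => simp
    | succ m => simp [Function.iterate_succ_apply, h, hnone]
  rw [this, csSup_singleton]

def ge0 {n : ℕ} (b : Tup n) : ℕ := xc b 1 + (xc b 2 - xbc b 2)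
def gf1 {n : ℕ} (b : Tup n) : ℕ := xc b 1 + (xbc b 2 - xc b 2)

theorem e0_step {n : ℕ} (hn : 2 ≤ n) (u v : Tup n) (h : eA n 0 u = some v) :
    ge0 u = ge0 v + 1 := by
  have h1 : 1 < n := by omega
  have h0 : 0 < n := by omega
  simp only [eA, if_true, h1] at h
  split_ifs at h with ha hb
  · simp only [Option.some.injEq] at h
    subst h
    simp [ge0, xc, xbc, setx, h1, h0] at *
    omega
  · simp only [Option.some.injEq] at h
    subst h
    simp [ge0, xc, xbc, setx, h1, h0] at *
    omega

theorem e0_ex {n : ℕ} (hn : 2 ≤ n) (u : Tup n) (h : 0 < ge0 u) :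
    ∃ v, eA n 0 u = some v := by
  have h1 : 1 < n := by omega
  simp only [eA, if_true, h1]
  unfold ge0 at h
  split_ifs with ha hb
  · exact ⟨_, rfl⟩
  · exact ⟨_, rfl⟩
  · omega

theorem f1_step {n : ℕ} (hn : 2 ≤ n) (u v : Tup n) (h : fA n 1 u = some v) :
    gf1 u = gf1 v + 1 := by
  have h1 : 1 < n := by omega
  have h0 : 0 < n := by omega
  have h2 : 1 ≠ n := by omega
  simp only [fA, one_ne_zero, if_false, h2, h1, if_true] at h
  split_ifs at h with ha hb
  · simp only [Option.some.injEq] at h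
    subst h
    simp [gf1, xc, xbc, setx, h1, h0] at *
    omega
  · simp only [Option.some.injEq] at h
    subst h
    simp [gf1, xc, xbc, setx, h1, h0] at *
    omega

theorem f1_ex {n : ℕ} (hn : 2 ≤ n) (u : Tup n) (h : 0 < gf1 u) :
    ∃ v, fA n 1 u = some v := by
  have h1 : 1 < n := by omega
  have h2 : 1 ≠ n := by omega
  simp only [fA, one_ne_zero, if_false, h2, h1, if_true]
  unfold gf1 at h
  split_ifs with ha hb
  · exact ⟨_, rfl⟩
  · simp only [Nat.reduceAdd] at *
    omega
  · exact ⟨_, rfl⟩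

theorem eps0_eq {n : ℕ} (hn : 2 ≤ n) (u : Tup n) : epsA n 0 u = ge0 u :=
  iter_sSup (eA n 0) ge0 (e0_step hn) (e0_ex hn) u

theorem phi1_eq {n : ℕ} (hn : 2 ≤ n) (u : Tup n) : phiA n 1 u = gf1 u :=
  iter_sSup (fA n 1) gf1 (f1_step hn) (f1_ex hn) u

theorem f0_uvec (n l : ℕ) (hn : 2 ≤ n) : fA n 0 (uvec n l) = none := by
  have h1 : 1 < n := by omega
  have h0 : 0 < n := by omega
  simp [fA, uvec, xc, xbc, h1]

theorem e1_uvec (n l : ℕ) (hn : 2 ≤ n) : eA n 1 (uvec n l) = none := by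
  have h1 : 1 < n := by omega
  have h2 : 1 ≠ n := by omega
  simp [eA, uvec, xc, xbc, h1, h2]

theorem eT_step {n : ℕ} (hn : 2 ≤ n) (u v : Tup n × Tup n) (h : eTenA n 0 u = some v) :
    ge0 u.1 + ge0 u.2 = ge0 v.1 + ge0 v.2 + 1 := by
  unfold eTenA at h
  split_ifs at h
  · obtain ⟨c, hc, rfl⟩ := Option.map_eq_some_iff.1 h
    have := e0_step hn _ _ hc
    simp only; omega
  · obtain ⟨c, hc, rfl⟩ := Option.map_eq_some_iff.1 h
    have := e0_step hn _ _ hc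
    simp only; omega

theorem fT_step {n : ℕ} (hn : 2 ≤ n) (u v : Tup n × Tup n) (h : fTenA n 1 u = some v) :
    gf1 u.1 + gf1 u.2 = gf1 v.1 + gf1 v.2 + 1 := by
  unfold fTenA at h
  split_ifs at h
  · obtain ⟨c, hc, rfl⟩ := Option.map_eq_some_iff.1 h
    have := f1_step hn _ _ hc
    simp only; omega
  · obtain ⟨c, hc, rfl⟩ := Option.map_eq_some_iff.1 h
    have := f1_step hn _ _ hc
    simp only; omega

theorem eT_ex {n : ℕ} (hn : 2 ≤ n) (u : Tup n × Tup n)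
    (hP : fA n 0 u.1 = none ∨ ge0 u.2 = 0) (h : 0 < ge0 u.1 + ge0 u.2) :
    ∃ v, eTenA n 0 u = some v ∧ (fA n 0 v.1 = none ∨ ge0 v.2 = 0) := by
  unfold eTenA
  rw [eps0_eq hn]
  by_cases h0 : ge0 u.2 = 0
  · obtain ⟨c, hc⟩ := e0_ex hn u.1 (by omega)
    exact ⟨(c, u.2), by simp [h0, hc], Or.inr h0⟩
  · have hf := hP.resolve_right h0
    have hphi : phiA n 0 u.1 = 0 := iter_sSup_zero _ _ hf
    obtain ⟨c, hc⟩ := e0_ex hn u.2 (by omega)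
    exact ⟨(u.1, c), by simp [h0, hc, hphi], Or.inl hf⟩

theorem fT_ex {n : ℕ} (hn : 2 ≤ n) (u : Tup n × Tup n)
    (hP : eA n 1 u.2 = none ∨ gf1 u.1 = 0) (h : 0 < gf1 u.1 + gf1 u.2) :
    ∃ v, fTenA n 1 u = some v ∧ (eA n 1 v.2 = none ∨ gf1 v.1 = 0) := by
  unfold fTenA
  rw [phi1_eq hn]
  by_cases h0 : gf1 u.1 = 0
  · obtain ⟨c, hc⟩ := f1_ex hn u.2 (by omega)
    exact ⟨(u.1, c), by simp [h0, hc], Or.inr h0⟩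
  · have hf := hP.resolve_right h0
    have hphi : epsA n 1 u.2 = 0 := iter_sSup_zero _ _ hf
    obtain ⟨c, hc⟩ := f1_ex hn u.1 (by omega)
    exact ⟨(c, u.2), by simp [hc, hphi, Nat.pos_of_ne_zero h0], Or.inl hf⟩

theorem tsum_bound {n : ℕ} (hn : 2 ≤ n) (b : Tup n) :
    xc b 1 + xc b 2 + xbc b 2 ≤ tsum b := by
  obtain ⟨m, rfl⟩ : ∃ m, n = m + 2 := ⟨n - 2, by omega⟩
  simp only [tsum, Fin.sum_univ_succ, xc, xbc]
  simp
  omega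

theorem eq_uvec {n : ℕ} (hn : 2 ≤ n) (b : Tup n) (h : tsum b ≤ xc b 1) :
    b = uvec n (tsum b) := by
  obtain ⟨m, rfl⟩ : ∃ m, n = m + 1 := ⟨n - 1, by omega⟩
  have hx : xc b 1 = b.1 0 := by simp [xc]
  rw [hx] at h
  have hs : tsum b = b.1 0 + b.2 0 + ∑ i : Fin m, (b.1 i.succ + b.2 i.succ) := by
    simp [tsum, Fin.sum_univ_succ]
  have hz : ∑ i : Fin m, (b.1 i.succ + b.2 i.succ) = 0 := by omega
  have hb : b.2 0 = 0 := by omega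
  have ht : tsum b = b.1 0 := by omega
  rw [Finset.sum_eq_zero_iff] at hz
  rw [ht]
  apply Prod.ext
  · funext j
    refine Fin.cases ?_ (fun i => ?_) j
    · simp [uvec]
    · have := hz i (Finset.mem_univ _)
      simp [uvec]; omega
  · funext j
    refine Fin.cases ?_ (fun i => ?_) j
    · simp [uvec, hb]
    · have := hz i (Finset.mem_univ _)
      simp [uvec]; omega

theorem ge0_uvec (n l : ℕ) (hn : 2 ≤ n) : ge0 (uvec n l) = l := by
  have h0 : 0 < n := by omega
  simp [ge0, uvec, xc, xbc, h0]

theorem gf1_uvec (n l : ℕ) (hn : 2 ≤ n) : gf1 (uvec n l) = l := by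
  have h0 : 0 < n := by omega
  simp [gf1, uvec, xc, xbc, h0]

/-- In the `U_q'(A_{2n-1}^{(2)})` crystal `B_l ⊗ B_k`, an element `u` satisfies both
`ẽ_0^{l+k}(u) ≠ 0` and `f̃_1^{l+k}(u) ≠ 0` if and only if `u = (l,0,…,0) ⊗ (k,0,…,0)`. -/
theorem unique_survivor_A
    (n l k : ℕ) (hn : 2 ≤ n) (hl : 1 ≤ l) (hk : 1 ≤ k) :
    ∀ u ∈ BA n l ×ˢ BA n k,
      (((fun o => Option.bind o (eTenA n 0))^[l + k] (some u) ≠ none ∧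
        (fun o => Option.bind o (fTenA n 1))^[l + k] (some u) ≠ none) ↔
        u = (uvec n l, uvec n k)) := by
  rintro ⟨b, c⟩ ⟨hb, hc⟩
  change tsum b = l at hb
  change tsum c = k at hc
  constructor
  · rintro ⟨he, hf⟩
    have he := iter_bound (eTenA n 0) (fun u => ge0 u.1 + ge0 u.2) (eT_step hn) _ _ he
    have hf := iter_bound (fTenA n 1) (fun u => gf1 u.1 + gf1 u.2) (fT_step hn) _ _ hf
    have hbb := tsum_bound hn b
    have hcb := tsum_bound hn c
    simp only [ge0, gf1] at he hf
    have h1 := eq_uvec hn b (by omega)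
    have h2 := eq_uvec hn c (by omega)
    rw [hb] at h1
    rw [hc] at h2
    rw [← h1, ← h2]
  · intro h
    rw [h]
    constructor
    · exact iter_exists (eTenA n 0) (fun u => ge0 u.1 + ge0 u.2)
        (fun u => fA n 0 u.1 = none ∨ ge0 u.2 = 0) (eT_step hn) (eT_ex hn) _ _
        (Or.inl (f0_uvec n l hn)) (by simp [ge0_uvec n _ hn])
    · exact iter_exists (fTenA n 1) (fun u => gf1 u.1 + gf1 u.2)
        (fun u => eA n 1 u.2 = none ∨ gf1 u.1 = 0) (fT_step hn) (fT_ex hn) _ _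
        (Or.inl (e1_uvec n k hn)) (by simp [gf1_uvec n _ hn])

end KTT
end

section
/- Classification of highest elements (A case): Let n ≥ 2 and l ≥ k ≥ 1, and let b_1 ⊗ b_2 belong to the U_q'(A_{2n−1}^(2)) crystal B_l ⊗ B_k with ẽ_i(b_1 ⊗ b_2) = 0 for all 1 ≤ i ≤ n. Then b_1 = (l,0,…,0), and b_2 = (x_1,x_2,---,x̄_1) for some nonnegative integers x_1, x_2, x̄_1 with x_1 + x_2 + x̄_1 = k (i.e. all entries of b_2 other than x_1, x_2, x̄_1 vanish). -/
namespace KTT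

theorem eA_lt {n i : ℕ} (hi : 1 ≤ i) {b c : Tup n} (h : eA n i b = some c) :
    (if i = n then xbc c n else xc c (i+1) + xbc c i) <
    (if i = n then xbc b n else xc b (i+1) + xbc b i) := by
  have hi0 : i ≠ 0 := by omega
  unfold eA at h
  rw [if_neg hi0] at h
  split_ifs at h with h1 h2 h3 h4 h5
  · subst h1
    cases h
    have : i - 1 + 1 = i := by omega
    have h6 : i - 1 < i := by omega
    simp only [xbc, setx, if_true, h6, this, dite_true] at h2 ⊢
    omega
  · cases h
    have e1 : i - 1 + 1 = i := by omega
    have e2 : i - 1 < n := by omega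
    simp [xc, xbc, setx, h1, h3, e1, e2] at h4 ⊢
    omega
  · cases h
    have e1 : i - 1 + 1 = i := by omega
    have e2 : i - 1 < n := by omega
    simp [xc, xbc, setx, h1, h3, e1, e2] at h5 ⊢
    omega

theorem eAIter_le {n i : ℕ} (hi : 1 ≤ i) (m : ℕ) : ∀ b : Tup n, eAIter n i m b ≠ none →
    m ≤ (if i = n then xbc b n else xc b (i+1) + xbc b i) := by
  have hnone : ∀ m, (fun o => Option.bind o (eA n i))^[m] none = none := by
    intro m
    induction m with
    | zero => rfl
    | succ m ih => rw [Function.iterate_succ_apply]; exact ih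
  induction m with
  | zero => intro b _; exact Nat.zero_le _
  | succ m ih =>
    intro b hb
    unfold eAIter at hb ih
    rw [Function.iterate_succ_apply, Option.bind_some] at hb
    rcases h : eA n i b with _ | c
    · rw [h, hnone] at hb; exact absurd rfl hb
    · rw [h] at hb
      have h1 := ih c hb
      have h2 := eA_lt hi h
      omega

theorem eA_none_of_eps {n i : ℕ} (hi : 1 ≤ i) {b : Tup n} (h : epsA n i b = 0) :
    eA n i b = none := by
  by_contra hne
  have h1 : 1 ≤ epsA n i b :=
    le_csSup ⟨_, fun m hm => eAIter_le hi m b hm⟩ (by simpa [eAIter] using hne)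
  omega

theorem eps_zero {n i : ℕ} {b : Tup n} (h : eA n i b = none) : epsA n i b = 0 := by
  have hm : ∀ m, eAIter n i m b ≠ none → m = 0 := by
    intro m
    induction m with
    | zero => intro _; rfl
    | succ m ih =>
      intro hb
      exfalso
      unfold eAIter at hb ih
      rw [Function.iterate_succ_apply'] at hb
      by_cases h0 : m = 0
      · subst h0; exact hb (by simpa using h)
      · have : (fun o => Option.bind o (eA n i))^[m] (some b) = none := by
          by_contra hc; exact h0 (ih hc)
        rw [this] at hb; exact hb rfl
  apply Nat.le_zero.1
  exact csSup_le ⟨0, by simp [eAIter]⟩ (fun m h => (hm m h).le)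

theorem phi_zero {n i : ℕ} {b : Tup n} (h : fA n i b = none) : phiA n i b = 0 := by
  have hm : ∀ m, fAIter n i m b ≠ none → m = 0 := by
    intro m
    induction m with
    | zero => intro _; rfl
    | succ m ih =>
      intro hb
      exfalso
      unfold fAIter at hb ih
      rw [Function.iterate_succ_apply'] at hb
      by_cases h0 : m = 0
      · subst h0; exact hb (by simpa using h)
      · have : (fun o => Option.bind o (fA n i))^[m] (some b) = none := by
          by_contra hc; exact h0 (ih hc)
        rw [this] at hb; exact hb rfl
  apply Nat.le_zero.1
  exact csSup_le ⟨0, by simp [fAIter]⟩ (fun m h => (hm m h).le)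

/-- Vanishing pattern forced by `ẽ_i b = 0` for all `i` with `s ≤ i ≤ n`. -/
theorem vanish {n s : ℕ} (hs : 1 ≤ s) {b : Tup n}
    (h : ∀ i, s ≤ i → i ≤ n → eA n i b = none) :
    (∀ j : Fin n, s ≤ j + 1 → b.2 j = 0) ∧ (∀ j : Fin n, s ≤ j → b.1 j = 0) := by
  have A : ∀ j : Fin n, s ≤ j + 1 → b.2 j = 0 := by
    intro j hj
    have hjn := j.2
    have := h (j + 1) hj (by omega)
    unfold eA at this
    rw [if_neg (by omega)] at this
    split_ifs at this with h1 h2 h3 h4 h5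
    · have e : (n - 1) = j := by omega
      simpa [xbc, e] using h2
    · simpa [xbc] using h5
    · omega
  refine ⟨A, ?_⟩
  intro j hj
  have hjn := j.2
  have := h j hj (by omega)
  unfold eA at this
  rw [if_neg (by omega), if_neg (by omega), if_pos hjn] at this
  split_ifs at this with h1 h2
  have h3 := A j (by omega)
  simp [xc, xbc] at h1
  omega

/-- **Classification of `U_q(C_n)` highest elements, `A_{2n-1}^{(2)}` case.**  A highest
element of `B_l ⊗ B_k` (with `l ≥ k`) has the form
`(l,0,…,0) ⊗ (x_1,x_2,---,x̄_1)` with `x_1 + x_2 + x̄_1 = k`. -/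
theorem classification_highest_A
    (n l k : ℕ) (hn : 2 ≤ n) (hk : 1 ≤ k) (hkl : k ≤ l)
    (b1 b2 : Tup n) (hb1 : b1 ∈ BA n l) (hb2 : b2 ∈ BA n k)
    (hhigh : ∀ i, 1 ≤ i → i ≤ n → eTenA n i (b1, b2) = none) :
    b1 = uvec n l ∧ ∃ a c d : ℕ, a + c + d = k ∧ b2 = tripleVec n a c d := by
  have key : ∀ i, 1 ≤ i → i ≤ n → epsA n i b2 ≤ phiA n i b1 ∧ eA n i b1 = none := by
    intro i h1 h2
    have := hhigh i h1 h2
    unfold eTenA at this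
    split_ifs at this with h
    · exact ⟨h, by simpa using this⟩
    · have h3 : eA n i b2 = none := by simpa using this
      have h4 := eps_zero h3
      simp only at h
      omega
  obtain ⟨v1, v2⟩ := vanish (le_refl 1) (fun i h1 h2 => (key i h1 h2).2)
  have f0 : ∀ i, 2 ≤ i → i ≤ n → fA n i b1 = none := by
    intro i h1 h2
    have e1 : xc b1 i = 0 := by
      unfold xc
      rw [dif_pos (by omega)]
      exact v2 _ (by simp only; omega)
    have e2 : xbc b1 (i+1) = 0 := by
      unfold xbc
      split_ifs
      · exact v1 _ (by omega)
      · rfl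
    unfold fA
    rw [if_neg (by omega)]
    split_ifs with g1 g2 g3 g4 g5
    · subst g1; omega
    · rfl
    · omega
    · rfl
    · omega
    · rfl
  have e0 : ∀ i, 2 ≤ i → i ≤ n → eA n i b2 = none := by
    intro i h1 h2
    apply eA_none_of_eps (by omega)
    have := (key i (by omega) h2).1
    have := phi_zero (f0 i h1 h2)
    omega
  obtain ⟨w1, w2⟩ := vanish (by omega) e0
  obtain ⟨m, rfl⟩ : ∃ m, n = m + 2 := ⟨n - 2, by omega⟩
  have s1 : ∑ i, (b1.1 i + b1.2 i) = l := hb1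
  have s2 : ∑ i, (b2.1 i + b2.2 i) = k := hb2
  constructor
  · rw [Fin.sum_univ_succ, Finset.sum_eq_zero] at s1
    · have := v1 0 (by simp)
      refine Prod.ext (funext fun j => ?_) (funext fun j => v1 j (by omega))
      simp only [uvec]
      split_ifs with h
      · obtain rfl : j = 0 := Fin.ext h
        omega
      · exact v2 j (by omega)
    · intro i _
      rw [v1 _ (by omega), v2 _ (by simp), add_zero]
  · refine ⟨b2.1 0, b2.1 1, b2.2 0, ?_, ?_⟩
    · rw [Fin.sum_univ_succ, Fin.sum_univ_succ, Finset.sum_eq_zero] at s2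
      · have := w1 1 (by simp)
        simp only [Fin.succ_zero_eq_one] at s2
        omega
      · intro i _
        rw [w1 _ (by simp), w2 _ (by simp), add_zero]
    · refine Prod.ext (funext fun j => ?_) (funext fun j => ?_)
      · simp only [tripleVec]
        split_ifs with h h'
        · rw [show j = 0 from Fin.ext h]
        · rw [show j = 1 from Fin.ext (by simpa using h')]
        · exact w2 j (by omega)
      · simp only [tripleVec]
        split_ifs with h
        · rw [show j = 0 from Fin.ext h]
        · exact w1 j (by omega)

end KTT
end
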